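/- arXiv:1607.02067 — 2 statements merged into one kernel-verified Lean document; each statement's English description precedes it below -/
import Mathlib

section
/- Assume 0 < K ≤ κ + α(s) for all s. Then the piecewise function G¹, defined by G¹(t) := G¹_m(t) for t ∈ [T_{m−1}, T_m), m = 1,…,n, is strictly positive on the whole interval [T₀, T_n). -/
open intervalIntegral Real Filter

/-- `exp(-∫₀ᵗ α(s) ds)`. -/
noncomputable def ed (α : ℝ → ℝ) (t : ℝ) : ℝ := Real.exp (-∫ s in (0:ℝ)..t, α s)

/-- `c_i = exp(-∫₀^{T_i} α(s) ds)`. -/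
noncomputable def c (α : ℝ → ℝ) (T : ℕ → ℝ) (i : ℕ) : ℝ := ed α (T i)

/-- `G¹_m(t) = exp(-∫₀ᵗ α) - c_n e^{-κ(T_n-t)} - c_m (T_m-t) K e^{-κ(T_m-t)}
  - ΔK ∑_{j=m+1}^n c_j e^{-κ(T_j-t)}`. -/
noncomputable def G1 (α : ℝ → ℝ) (T : ℕ → ℝ) (n : ℕ) (κ Δ K : ℝ) (m : ℕ) (t : ℝ) : ℝ :=
  ed α t - c α T n * Real.exp (-κ * (T n - t))
    - c α T m * ((T m - t) * K) * Real.exp (-κ * (T m - t))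
    - Δ * K * ∑ j ∈ Finset.Icc (m + 1) n, c α T j * Real.exp (-κ * (T j - t))

/-- `Ĝ¹_m(t) = exp(-∫₀ᵗ α) - c_n - c_m (T_m-t) K - ΔK ∑_{j=m+1}^n c_j`. -/
noncomputable def Ghat1 (α : ℝ → ℝ) (T : ℕ → ℝ) (n : ℕ) (Δ K : ℝ) (m : ℕ) (t : ℝ) : ℝ :=
  ed α t - c α T n - c α T m * ((T m - t) * K)
    - Δ * K * ∑ j ∈ Finset.Icc (m + 1) n, c α T j

/-- `G²_m(t) = θ(Ĝ¹_m(t) − G¹_m(t)) + Ĝ¹_m(t)`. -/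
noncomputable def G2 (α : ℝ → ℝ) (T : ℕ → ℝ) (n : ℕ) (κ θ Δ K : ℝ) (m : ℕ) (t : ℝ) : ℝ :=
  θ * (Ghat1 α T n Δ K m t - G1 α T n κ Δ K m t) + Ghat1 α T n Δ K m t

/-- `π_m(t) = (1/κ)[exp(−∫₀ᵗ α)(κ + α(t)) − c_m K e^{−κ(T_m−t)}]`. -/
noncomputable def piF (α : ℝ → ℝ) (T : ℕ → ℝ) (κ K : ℝ) (m : ℕ) (t : ℝ) : ℝ :=
  (1 / κ) * (ed α t * (κ + α t) - c α T m * K * Real.exp (-κ * (T m - t)))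

/-- `H¹_m(t) = −(κ + α(t)) exp(−∫₀ᵗ α) + c_m K e^{−κ(T_m−t)}`. -/
noncomputable def H1 (α : ℝ → ℝ) (T : ℕ → ℝ) (κ K : ℝ) (m : ℕ) (t : ℝ) : ℝ :=
  -(κ + α t) * ed α t + c α T m * K * Real.exp (-κ * (T m - t))

/-- The killed discount factor `ed α s * exp(-κ(s - t))` drops by a factor of more than
`1 + K (u - s)` over `[s, u]` when its decay rate `κ + α` is at least `K`. -/
theorem ed_mul_exp_lt {α : ℝ → ℝ} (hα : Continuous α) {κ K : ℝ} (hK : 0 < K)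
    (hKκα : ∀ s, K ≤ κ + α s) (t : ℝ) {s u : ℝ} (hsu : s < u) :
    ed α u * Real.exp (-κ * (u - t)) * (1 + K * (u - s)) < ed α s * Real.exp (-κ * (s - t)) := by
  have hint (a b : ℝ) : IntervalIntegrable α MeasureTheory.volume a b := hα.intervalIntegrable a b
  have hadd := integral_add_adjacent_intervals (hint 0 s) (hint s u)
  have hmono : ∫ _ in s..u, (K - κ) ≤ ∫ x in s..u, α x :=
    integral_mono_on hsu.le (continuous_const.intervalIntegrable s u) (hint s u)
      fun x _ => by linarith [hKκα x]
  rw [integral_const, smul_eq_mul] at hmono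
  have hpos : 0 < K * (u - s) := mul_pos hK (sub_pos.2 hsu)
  unfold ed
  rw [← Real.exp_add, ← Real.exp_add]
  calc _ < Real.exp (-(∫ x in (0:ℝ)..u, α x) + -κ * (u - t)) * Real.exp (K * (u - s)) := by
        gcongr
        linarith [Real.add_one_lt_exp hpos.ne']
    _ ≤ _ := by
        rw [← Real.exp_add]
        exact Real.exp_le_exp.2 (by linarith)

/-- Telescoped form of the one-step bound along an equidistant tenor. -/
theorem sum_le_sub_of_step {f : ℕ → ℝ} {b : ℝ} {m n : ℕ} (hmn : m ≤ n)
    (hf : ∀ j, m ≤ j → j < n → f (j + 1) * (1 + b) ≤ f j) :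
    b * ∑ j ∈ Finset.Icc (m + 1) n, f j ≤ f m - f n := by
  induction n, hmn using Nat.le_induction with
  | base => simp
  | succ k hk ih =>
    rw [Finset.sum_Icc_succ_top (by lia)]
    linarith [ih fun j hj hjk => hf j hj (by lia), hf k hk (by lia)]

/-- If `0 < K ≤ κ + α(s)` for all `s`, the piecewise function `G¹`
(equal to `G¹_m` on `[T_{m-1}, T_m)`) is strictly positive on `[T₀, T_n)`. -/
theorem stmt_9 (n : ℕ) (hn : 1 ≤ n) (T : ℕ → ℝ) (Δ κ θ K : ℝ)
    (hT0 : 0 < T 0) (hΔ : 0 < Δ)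
    (hten : ∀ i, 1 ≤ i → i ≤ n → T i - T (i - 1) = Δ)
    (hκ : 0 < κ) (hθ : 0 < θ) (α : ℝ → ℝ) (hα : Continuous α)
    (hK : 0 < K) (hKκα : ∀ s, K ≤ κ + α s) :
    ∀ m, 1 ≤ m → m ≤ n → ∀ t, T (m - 1) ≤ t → t < T m →
      0 < G1 α T n κ Δ K m t := by
  intro m _ hmn t _ htm
  have hstep := ed_mul_exp_lt hα hK hKκα t htm
  have hsum := sum_le_sub_of_step
    (f := fun j => c α T j * Real.exp (-κ * (T j - t))) (b := Δ * K) hmn fun j _ hj => by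
      have hd : T (j + 1) - T j = Δ := hten (j + 1) (by lia) (by lia)
      have h := ed_mul_exp_lt hα hK hKκα t (s := T j) (u := T (j + 1)) (by linarith)
      rw [hd, mul_comm K Δ] at h
      exact h.le
  rw [sub_self, mul_zero, Real.exp_zero, mul_one] at hstep
  simp only [G1, c] at hsum ⊢
  linarith
end

section
/- Assume κ > 0, θ > 0 and α(s) ≥ θκ for all s. Then for every m = 1,…,n and every t ∈ [T_{m−1}, T_m) with t < T_n, the map x ↦ f₁(t,x)/f₂(t,x) is strictly increasing on (0, ∞); that is, the swap rate is a strictly increasing function of the factor value. -/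
open intervalIntegral Real Filter

/-- Zero-coupon bond price
`P(t,T;x) = exp(−∫ₜ^T α)(1 + θ + e^{−κ(T−t)}(x − θ))/(1 + x)`. -/
noncomputable def P (α : ℝ → ℝ) (κ θ t T x : ℝ) : ℝ :=
  Real.exp (-∫ s in t..T, α s) *
    ((1 + θ + Real.exp (-κ * (T - t)) * (x - θ)) / (1 + x))

/-- Numerator `f₁(t,x)` of the linear-rational expression of the swap rate. -/
noncomputable def f1 (α : ℝ → ℝ) (κ θ : ℝ) (T : ℕ → ℝ) (n : ℕ) (t x : ℝ) : ℝ :=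
  x * (1 - Real.exp (-∫ s in t..(T n), (κ + α s)))
    + 1 - Real.exp (-∫ s in t..(T n), α s) * (1 + θ)
    + θ * Real.exp (-∫ s in t..(T n), (κ + α s))

/-- Denominator `f₂(t,x)` of the linear-rational expression of the swap rate
(for `t` in the `m`-th period). -/
noncomputable def f2 (α : ℝ → ℝ) (κ θ Δ : ℝ) (T : ℕ → ℝ) (n m : ℕ) (t x : ℝ) : ℝ :=
  x * ((T m - t) * Real.exp (-∫ s in t..(T m), (κ + α s))
      + Δ * ∑ j ∈ Finset.Icc (m + 1) n, Real.exp (-∫ s in t..(T j), (κ + α s)))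
    + (T m - t) * Real.exp (-∫ s in t..(T m), α s)
        * (1 + θ - θ * Real.exp (-κ * (T m - t)))
    + Δ * ∑ j ∈ Finset.Icc (m + 1) n,
        Real.exp (-∫ s in t..(T j), α s) * (1 + θ - θ * Real.exp (-κ * (T j - t)))

theorem exp_neg_integral_const_add (α : ℝ → ℝ) (hα : Continuous α) (κ a b : ℝ) :
    Real.exp (-∫ s in a..b, (κ + α s)) =
      Real.exp (-∫ s in a..b, α s) * Real.exp (-κ * (b - a)) := by
  rw [integral_add intervalIntegrable_const (hα.intervalIntegrable a b), integral_const,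
    ← Real.exp_add]
  congr 1
  simp only [smul_eq_mul]
  ring

theorem strictMonoOn_linear_div_linear {a b c d : ℝ} (hc : 0 < c) (hd : 0 < d)
    (h : b * c < a * d) :
    StrictMonoOn (fun x => (x * a + b) / (x * c + d)) (Set.Ioi (0 : ℝ)) := by
  intro x hx y hy hxy
  have hx : 0 < x := hx
  have hy : 0 < y := hy
  change (x * a + b) / (x * c + d) < (y * a + b) / (y * c + d)
  rw [div_lt_div_iff₀ (by positivity) (by positivity)]
  linear_combination mul_pos (sub_pos.2 hxy) (sub_pos.2 h)

/-- Cross-product inequality behind the monotonicity of the swap rate, for a single payment date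
with mean-reversion factor `e` preceding the final date, whose factor is `u`. -/
theorem bond_cross_lt {θ A e u : ℝ} (hθ : 0 < θ) (hA : 0 < A) (hue : u ≤ e) (he : e < 1) :
    (1 - A * (1 + θ - θ * u)) * e < (1 - A * u) * (1 + θ - θ * e) := by
  have h : 0 < (1 + θ) * ((1 - e) + A * (e - u)) :=
    mul_pos (by linarith) (add_pos_of_pos_of_nonneg (by linarith)
      (mul_nonneg hA.le (by linarith)))
  linear_combination h

theorem tenor_eq {n : ℕ} {T : ℕ → ℝ} {Δ : ℝ}
    (hten : ∀ i, 1 ≤ i → i ≤ n → T i - T (i - 1) = Δ) :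
    ∀ i, i ≤ n → T i = T 0 + i * Δ := by
  intro i
  induction i with
  | zero => simp
  | succ k ih =>
    intro hk
    have h₁ := hten (k + 1) (by omega) hk
    have h₂ := ih (by omega)
    rw [Nat.add_sub_cancel] at h₁
    push_cast
    linarith

/-- If `α(s) ≥ θκ` for all `s` (nonnegative interest rates), the swap rate
`x ↦ f₁(t,x)/f₂(t,x)` is strictly increasing in the factor value on `(0, ∞)`. -/
theorem stmt_17 (n : ℕ) (hn : 1 ≤ n) (T : ℕ → ℝ) (Δ κ θ : ℝ)
    (hT0 : 0 < T 0) (hΔ : 0 < Δ)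
    (hten : ∀ i, 1 ≤ i → i ≤ n → T i - T (i - 1) = Δ)
    (hκ : 0 < κ) (hθ : 0 < θ) (α : ℝ → ℝ) (hα : Continuous α)
    (hαθκ : ∀ s, θ * κ ≤ α s)
    (m : ℕ) (hm : 1 ≤ m) (hmn : m ≤ n)
    (t : ℝ) (ht1 : T (m - 1) ≤ t) (ht2 : t < T m) (htn : t < T n) :
    StrictMonoOn (fun x => f1 α κ θ T n t x / f2 α κ θ Δ T n m t x)
      (Set.Ioi (0 : ℝ)) := by
  have hmono : ∀ i j, i ≤ j → j ≤ n → T i ≤ T j := by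
    intro i j hij hj
    rw [tenor_eq hten i (hij.trans hj), tenor_eq hten j hj]
    gcongr
  set A : ℝ → ℝ := fun S => Real.exp (-∫ s in t..S, α s)
  set E : ℝ → ℝ := fun S => Real.exp (-κ * (S - t))
  have hApos : ∀ S, 0 < A S := fun S => Real.exp_pos _
  have hEpos : ∀ S, 0 < E S := fun S => Real.exp_pos _
  have hElt : ∀ S, t < S → E S < 1 := fun S hS =>
    Real.exp_lt_one_iff.2 (by nlinarith)
  have hQ : ∀ S, Real.exp (-∫ s in t..S, (κ + α s)) = A S * E S :=
    exp_neg_integral_const_add α hα κ t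
  have hEanti : ∀ j, j ≤ n → E (T n) ≤ E (T j) := fun j hj =>
    Real.exp_le_exp.2 (by nlinarith [hmono j n hj le_rfl])
  have hlate : ∀ j ∈ Finset.Icc (m + 1) n, t < T j ∧ j ≤ n := fun j hj => by
    rw [Finset.mem_Icc] at hj
    exact ⟨ht2.trans_le (hmono m j (by omega) hj.2), hj.2⟩
  have hG : ∀ S, t < S → 0 < 1 + θ - θ * E S := fun S hS => by
    nlinarith [hElt S hS]
  have hτ : 0 < T m - t := sub_pos.2 ht2
  set a := 1 - A (T n) * E (T n)
  set b := 1 - A (T n) * (1 + θ - θ * E (T n))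
  set c := (T m - t) * (A (T m) * E (T m)) +
    Δ * ∑ j ∈ Finset.Icc (m + 1) n, A (T j) * E (T j)
  set d := (T m - t) * A (T m) * (1 + θ - θ * E (T m)) +
    Δ * ∑ j ∈ Finset.Icc (m + 1) n, A (T j) * (1 + θ - θ * E (T j))
  have hc : 0 < c :=
    add_pos_of_pos_of_nonneg (mul_pos hτ (mul_pos (hApos _) (hEpos _)))
      (mul_nonneg hΔ.le (Finset.sum_nonneg fun j _ => (mul_pos (hApos _) (hEpos _)).le))
  have hd : 0 < d :=
    add_pos_of_pos_of_nonneg (mul_pos (mul_pos hτ (hApos _)) (hG _ ht2))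
      (mul_nonneg hΔ.le (Finset.sum_nonneg fun j hj =>
        (mul_pos (hApos _) (hG _ (hlate j hj).1)).le))
  have hcross : ∀ j, j ≤ n → t < T j →
      b * (A (T j) * E (T j)) < a * (A (T j) * (1 + θ - θ * E (T j))) := by
    intro j hj htj
    linear_combination
      A (T j) * bond_cross_lt hθ (hApos (T n)) (hEanti j hj) (hElt _ htj)
  have hfirst := mul_lt_mul_of_pos_left (hcross m hmn ht2) hτ
  have hrest : b * ∑ j ∈ Finset.Icc (m + 1) n, A (T j) * E (T j) ≤
      a * ∑ j ∈ Finset.Icc (m + 1) n, A (T j) * (1 + θ - θ * E (T j)) := by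
    rw [Finset.mul_sum, Finset.mul_sum]
    exact Finset.sum_le_sum fun j hj => (hcross j (hlate j hj).2 (hlate j hj).1).le
  have hbc : b * c < a * d := by
    linear_combination hfirst + Δ * hrest
  refine (strictMonoOn_linear_div_linear hc hd hbc).congr fun x _ => ?_
  simp only [f1, f2, hQ]
  congr 1 <;> ring
end
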